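/- Let (U, ω) be a finite-dimensional b-alternative algebra over F with unity element 1, and let J be a nil b-ideal of U. Suppose u_{ij} ∈ bar(U) (1 ≤ i,j ≤ t) satisfy u_{ij}·u_{kl} − δ_{jk}·u_{il} ∈ J for all indices and u_{ii} ∉ J for all i (so the classes of the u_{ij} are matrix units of degree t in bar(U)/J, spanning a total matrix algebra with identity element the class of u_{11} + ⋯ + u_{tt}). Let f be an idempotent of bar(U) with f − (u_{11} + ⋯ + u_{tt}) ∈ J. Then there exist f_{ij} ∈ bar(U) (1 ≤ i,j ≤ t) with f_{ij}·f_{kl} = δ_{jk}·f_{il} for all indices, f_{ij} − u_{ij} ∈ J for all i,j, and f_{11} + ⋯ + f_{tt} = f; hence bar(U) contains a total matrix algebra of degree t with identity element f whose image modulo J is the given one. -/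

import Mathlib

/-! Lifting of a total matrix algebra modulo a nil b-ideal in a
finite-dimensional b-alternative algebra with unity. -/

/-- Left powers: `lpow x n = x^(n+1)`.  In an alternative (hence
power-associative) ring powers of a single element are unambiguous. -/
def lpow {U : Type*} [Mul U] (x : U) : ℕ → U
  | 0 => x
  | n + 1 => x * lpow x n

/-- An element is nil(potent) if some power of it vanishes. -/
def IsNilElem {U : Type*} [Mul U] [Zero U] (x : U) : Prop := ∃ n : ℕ, lpow x n = 0

/-- The left and right alternative laws. -/
def IsAlternative (U : Type*) [NonAssocRing U] : Prop :=
  ∀ x y : U, (x * x) * y = x * (x * y) ∧ (y * x) * x = y * (x * x)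

namespace IsAlternative

variable {U : Type*} [NonAssocRing U]

theorem left_linearized (h : IsAlternative U) (x y z : U) :
    (x * y) * z + (y * x) * z = x * (y * z) + y * (x * z) := by
  have h1 := (h (x + y) z).1
  have h2 := (h x z).1
  have h3 := (h y z).1
  simp only [mul_add, add_mul] at h1
  rw [h2, h3] at h1
  rw [← sub_eq_zero] at h1 ⊢
  rw [← h1]
  abel

theorem right_linearized (h : IsAlternative U) (x y z : U) :
    (z * x) * y + (z * y) * x = z * (x * y) + z * (y * x) := by
  have h1 := (h (x + y) z).2
  have h2 := (h x z).2
  have h3 := (h y z).2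
  simp only [mul_add, add_mul] at h1
  rw [h2, h3] at h1
  rw [← sub_eq_zero] at h1 ⊢
  rw [← h1]
  abel

/-- Associators are invariant under cyclic permutations. -/
theorem associator_cyclic (h : IsAlternative U) (x y z : U) :
    (x * y) * z - x * (y * z) = (y * z) * x - y * (z * x) := by
  have h1 := h.left_linearized x y z
  have h2 := h.right_linearized x z y
  rw [← sub_eq_zero] at h1 h2 ⊢
  rw [← sub_eq_zero.2 (h1.trans h2.symm)]
  abel

theorem flexible (h : IsAlternative U) (x y : U) : (x * y) * x = x * (y * x) := by
  have h1 := h.left_linearized x y x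
  rwa [(h x y).2, add_left_inj] at h1

theorem left_moufang (h : IsAlternative U) (x a y : U) :
    (x * (a * x)) * y = x * (a * (x * y)) := by
  have h1 := h.left_linearized x (x * a) y
  have h2 := h.right_linearized a (x * y) x
  have h3 := h.right_linearized a y (x * x)
  have h4 := congrArg (x * ·) (h.right_linearized a y x)
  simp only [← h.flexible, mul_add, (h _ _).1] at h1 h2 h3 h4 ⊢
  rw [← sub_eq_zero] at h1 h2 h3 h4 ⊢
  have h5 := congrArg₂ (· + ·) (congrArg₂ (· + ·) h1 h2) (congrArg₂ (· - ·) h4 h3)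
  beta_reduce at h5
  rw [sub_self, add_zero, add_zero] at h5
  rw [← h5]
  abel

theorem mul_mul_eq (h : IsAlternative U) (e x y : U) :
    e * (x * y) = (e * x) * y + (x * e) * y - x * (e * y) := by
  rw [h.left_linearized]
  abel

theorem mul_mul_eq' (h : IsAlternative U) (e x y : U) :
    (x * y) * e = x * (y * e) + x * (e * y) - (x * e) * y := by
  rw [← h.right_linearized]
  abel

variable {ι : Type*} [DecidableEq ι]

/-- `x` lies in the Peirce component of index `(i, j)` with respect to the family `e`. -/
def Peirce (e : ι → U) (i j : ι) (x : U) : Prop :=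
  ∀ k, e k * x = (if k = i then x else 0) ∧ x * e k = if k = j then x else 0

variable {e : ι → U} {i j k l : ι} {x y z : U}

theorem Peirce.left_mul (hx : Peirce e i j x) : e i * x = x := by
  simpa using (hx i).1

theorem Peirce.right_mul (hx : Peirce e i j x) : x * e j = x := by
  simpa using (hx j).2

theorem Peirce.sub (hx : Peirce e i j x) (hy : Peirce e i j y) : Peirce e i j (x - y) := by
  intro m
  rw [mul_sub, sub_mul, (hx m).1, (hx m).2, (hy m).1, (hy m).2]
  constructor <;> split_ifs <;> simp

theorem Peirce.neg (hx : Peirce e i j x) : Peirce e i j (-x) := by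
  intro m
  rw [mul_neg, neg_mul, (hx m).1, (hx m).2]
  constructor <;> split_ifs <;> simp

theorem Peirce.add (hx : Peirce e i j x) (hy : Peirce e i j y) : Peirce e i j (x + y) := by
  simpa using hx.sub hy.neg

theorem peirce_self (he : ∀ m n, e m * e n = if m = n then e m else 0) (i : ι) :
    Peirce e i i (e i) := by
  intro m
  rw [he, he]
  constructor <;> split_ifs <;> simp_all

theorem Peirce.eq_zero (hx : Peirce e i j x) (hx' : Peirce e k l x) (hik : i ≠ k) : x = 0 := by
  rw [← hx.left_mul, (hx' i).1, if_neg hik]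

theorem Peirce.mul (h : IsAlternative U) (hx : Peirce e i j x) (hy : Peirce e j k y) :
    Peirce e i k (x * y) := by
  intro m
  rw [h.mul_mul_eq (e m), h.mul_mul_eq' (e m), (hx m).1, (hx m).2, (hy m).1, (hy m).2]
  constructor <;> split_ifs <;> simp

theorem Peirce.mul_self (h : IsAlternative U) (hx : Peirce e i j x) (hij : i ≠ j) :
    x * x = 0 := by
  have h1 := h.mul_mul_eq' (e i) x x
  rwa [(h x (e i)).1, (hx i).1, (hx i).2, if_pos rfl, if_neg hij, mul_zero, zero_mul, zero_add,
    sub_zero, eq_comm] at h1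

theorem idem_mul (h : IsAlternative U) {c : U} (hc : c * c = c) (x : U) :
    c * (c * x) = c * x ∧ (x * c) * c = x * c := by
  rw [← (h c x).1, (h c x).2, hc]
  exact ⟨rfl, rfl⟩

/-- Corners of orthogonal idempotents annihilate each other, on the left. -/
theorem mul_eq_zero_left (h : IsAlternative U) (h2 : ∀ x : U, x + x = 0 → x = 0) {c : U}
    (hc : c * c = c) (hx : c * x = 0) (hx' : x * c = 0) (hy : c * y = y) : x * y = 0 := by
  have h1 := h.mul_mul_eq c x y
  rw [hx, hx', hy, zero_mul, zero_add, zero_sub] at h1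
  have h3 := (h.idem_mul hc (x * y)).1
  rw [h1, mul_neg, h1, neg_neg] at h3
  exact h2 _ (eq_neg_iff_add_eq_zero.1 h3)

theorem mul_eq_zero_right (h : IsAlternative U) (h2 : ∀ x : U, x + x = 0 → x = 0) {c : U}
    (hc : c * c = c) (hx : x * c = x) (hy : c * y = 0) (hy' : y * c = 0) : x * y = 0 := by
  have h1 := h.mul_mul_eq' c x y
  rw [hx, hy, hy', mul_zero, zero_add, zero_sub] at h1
  have h3 := (h.idem_mul hc (x * y)).2
  rw [h1, neg_mul, h1, neg_neg] at h3
  exact h2 _ (eq_neg_iff_add_eq_zero.1 h3)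

theorem Peirce.mul_eq_zero (h : IsAlternative U) (h2 : ∀ x : U, x + x = 0 → x = 0)
    (he : ∀ m, e m * e m = e m) (hx : Peirce e i j x) (hy : Peirce e k l y)
    (hjk : j ≠ k) (hne : ¬ (i = k ∧ j = l)) : x * y = 0 := by
  by_cases hik : i = k
  · refine h.mul_eq_zero_right h2 (he j) hx.right_mul ?_ ?_
    · rw [(hy j).1, if_neg hjk]
    · rw [(hy j).2, if_neg fun hjl => hne ⟨hik, hjl⟩]
  · refine h.mul_eq_zero_left h2 (he k) ?_ ?_ hy.left_mul
    · rw [(hx k).1, if_neg (Ne.symm hik)]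
    · rw [(hx k).2, if_neg hjk.symm]

/-- Left multiplications by orthogonal idempotents annihilate each other. -/
theorem orthogonal_mul_mul (h : IsAlternative U) (h2 : ∀ x : U, x + x = 0 → x = 0) {c d : U}
    (hc : c * c = c) (hcd : c * d = 0) (hdc : d * c = 0) (x : U) :
    c * (d * x) = 0 ∧ (x * d) * c = 0 := by
  constructor
  · have h1 : ∀ y, c * (d * y) = -(d * (c * y)) := fun y => by
      rw [h.mul_mul_eq, hcd, hdc, zero_mul, zero_add, zero_sub]
    have h3 : c * (d * x) = d * (c * x) := by
      rw [← (h.idem_mul hc (d * x)).1, h1 x, mul_neg, h1 (c * x), (h.idem_mul hc x).1, neg_neg]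
    exact h2 _ (eq_neg_iff_add_eq_zero.1 ((h1 x).trans (by rw [h3])))
  · have h1 : ∀ y, (y * d) * c = -((y * c) * d) := fun y => by
      rw [h.mul_mul_eq', hcd, hdc, mul_zero, zero_add, zero_sub]
    have h3 : (x * d) * c = (x * c) * d := by
      rw [← (h.idem_mul hc (x * d)).2, h1 x, neg_mul, h1 (x * c), (h.idem_mul hc x).2, neg_neg]
    exact h2 _ (eq_neg_iff_add_eq_zero.1 ((h1 x).trans (by rw [h3])))

theorem peirce_mul_mul (h : IsAlternative U) (h2 : ∀ x : U, x + x = 0 → x = 0)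
    (he : ∀ m n, e m * e n = if m = n then e m else 0) (i j : ι) (x : U) :
    Peirce e i j ((e i * x) * e j) := by
  have hid : ∀ m, e m * e m = e m := fun m => by simpa using he m m
  have hl : ∀ m n y, e m * (e n * y) = if m = n then e m * y else 0 := fun m n y => by
    split_ifs with hmn
    · rw [← hmn, (h.idem_mul (hid m) y).1]
    · exact (h.orthogonal_mul_mul h2 (hid m) (by simp [he, hmn])
        (by simp [he, Ne.symm hmn]) y).1
  have hr : ∀ m n y, (y * e n) * e m = if m = n then y * e n else 0 := fun m n y => by
    split_ifs with hmn
    · rw [hmn, (h.idem_mul (hid n) y).2]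
    · exact (h.orthogonal_mul_mul h2 (hid m) (by simp [he, hmn])
        (by simp [he, Ne.symm hmn]) y).2
  intro m
  constructor
  · by_cases hmj : m = j
    · subst hmj
      rw [← h.flexible, hl]
      split_ifs with hmi
      · rw [hmi]
      · rw [zero_mul]
    · rw [h.mul_mul_eq (e m), hl, hr, if_neg (Ne.symm hmj), he, if_neg hmj, mul_zero, sub_zero,
        add_zero]
      split_ifs with hmi
      · rw [hmi]
      · rw [zero_mul]
  · rw [hr]

/-- Factors whose indices form a nontrivial cycle associate. -/
theorem Peirce.assoc_cyclic (h : IsAlternative U) (hx : Peirce e i j x) (hy : Peirce e j k y)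
    (hz : Peirce e k i z) (hij : i ≠ j) : (x * y) * z = x * (y * z) := by
  rw [← sub_eq_zero]
  refine Peirce.eq_zero (e := e) (i := i) (k := j) (j := i) (l := j) ?_ ?_ hij
  · exact ((hx.mul h hy).mul h hz).sub (hx.mul h (hy.mul h hz))
  · rw [h.associator_cyclic]
    exact ((hy.mul h hz).mul h hx).sub (hy.mul h (hz.mul h hx))

theorem Peirce.assoc_cyclic' (h : IsAlternative U) (hx : Peirce e i j x) (hy : Peirce e j k y)
    (hz : Peirce e k i z) (hik : i ≠ k) : (x * y) * z = x * (y * z) := by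
  have := hz.assoc_cyclic h hx hy hik.symm
  rw [← sub_eq_zero, ← h.associator_cyclic z, this, sub_self]

section Lifting

variable {F U : Type*} [Field F] [NonAssocRing U] [Module F U]

theorem lpow_mul_self (h : IsAlternative U) (x : U) (n : ℕ) :
    lpow x n * x = lpow x (n + 1) := by
  induction n with
  | zero => rfl
  | succ n ih => rw [lpow, h.flexible, ih]; rfl

theorem eq_zero_of_isNilElem {x : U} (hx : x * x = x) (hnil : IsNilElem x) : x = 0 := by
  obtain ⟨n, hn⟩ := hnil
  suffices ∀ m, lpow x m = x by rw [← hn, this]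
  intro m
  induction m with
  | zero => rfl
  | succ m ih => rw [lpow, ih, hx]

theorem mul_sub_mul_mem {J : Submodule F U} (hJ : ∀ x ∈ J, ∀ y : U, y * x ∈ J ∧ x * y ∈ J)
    {x x' y y' : U} (hx : x - x' ∈ J) (hy : y - y' ∈ J) : x * y - x' * y' ∈ J := by
  have := J.add_mem (hJ _ hy x).1 (hJ _ hx y').2
  rwa [mul_sub, sub_mul, sub_add_sub_cancel] at this

/-- Elements congruent to a diagonal idempotent modulo a nil ideal are invertible in the
corresponding Peirce component. -/
theorem exists_left_inverse {ι : Type*} [DecidableEq ι] (h : IsAlternative U) {e : ι → U}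
    (he : ∀ m n, e m * e n = if m = n then e m else 0) (J : Submodule F U)
    (hJ : ∀ x ∈ J, ∀ y : U, y * x ∈ J ∧ x * y ∈ J) (hJnil : ∀ x ∈ J, IsNilElem x)
    {o : ι} {x : U} (hx : Peirce e o o x) (hxe : x - e o ∈ J) :
    ∃ b, Peirce e o o b ∧ b - e o ∈ J ∧ b * x = e o := by
  have heo := peirce_self he o
  obtain ⟨N, hN⟩ := hJnil _ (J.neg_mem hxe)
  set n := -(x - e o) with hn
  have hnP : Peirce e o o n := (hx.sub heo).neg
  have hpow : ∀ m, Peirce e o o (lpow n m) ∧ lpow n m ∈ J := by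
    intro m
    induction m with
    | zero => exact ⟨hnP, J.neg_mem hxe⟩
    | succ m ih => exact ⟨hnP.mul h ih.1, (hJ _ ih.2 _).1⟩
  have key : ∀ m, ∃ b, Peirce e o o b ∧ b - e o ∈ J ∧ b * x = e o - lpow n m := by
    intro m
    induction m with
    | zero =>
      refine ⟨e o, heo, by simp, ?_⟩
      rw [hx.left_mul, lpow, hn]
      abel
    | succ m ih =>
      obtain ⟨b, hb, hbJ, hbx⟩ := ih
      refine ⟨b + lpow n m, hb.add (hpow m).1, ?_, ?_⟩
      · rw [add_sub_right_comm]
        exact J.add_mem hbJ (hpow m).2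
      · have h3 := h.lpow_mul_self n m
        rw [add_mul, hbx, ← h3, show x = e o - n by rw [hn]; abel, mul_sub,
          (hpow m).1.right_mul]
        abel
  obtain ⟨b, hb, hbJ, hbx⟩ := key N
  exact ⟨b, hb, hbJ, by rw [hbx, hN, sub_zero]⟩

/-- Mutually inverse off-diagonal elements linking two idempotents lift modulo a nil ideal. -/
theorem exists_link_lift {ι : Type*} [DecidableEq ι] (h : IsAlternative U)
    (h2 : ∀ x : U, x + x = 0 → x = 0) {e : ι → U}
    (he : ∀ m n, e m * e n = if m = n then e m else 0) (J : Submodule F U)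
    (hJ : ∀ x ∈ J, ∀ y : U, y * x ∈ J ∧ x * y ∈ J) (hJnil : ∀ x ∈ J, IsNilElem x)
    (u : ι → ι → U) (hu : ∀ i j k l, u i j * u k l - (if j = k then u i l else 0) ∈ J)
    (heu : ∀ i, e i - u i i ∈ J) {o j : ι} (hoj : o ≠ j) :
    ∃ p q, Peirce e j o p ∧ Peirce e o j q ∧ q * p = e o ∧ p * q = e j ∧
      p - u j o ∈ J ∧ q - u o j ∈ J := by
  have hu' : ∀ i j k, u i j * u j k - u i k ∈ J := fun i j k => by simpa using hu i j j k
  have hcomp : ∀ i k, (e i * u i k) * e k - u i k ∈ J := fun i k => by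
    have h3 := mul_sub_mul_mem hJ (heu i) (y := u i k) (y' := u i k) (by simp)
    have h4 : e i * u i k - u i k ∈ J := by simpa using J.add_mem h3 (hu' i i k)
    simpa using J.add_mem (mul_sub_mul_mem hJ h4 (heu k)) (hu' i k k)
  set p := (e j * u j o) * e o with hp
  set a := (e o * u o j) * e j with ha
  have hpP : Peirce e j o p := h.peirce_mul_mul h2 he j o _
  have haP : Peirce e o j a := h.peirce_mul_mul h2 he o j _
  have hap : a * p - e o ∈ J := by
    simpa using J.sub_mem (J.add_mem (mul_sub_mul_mem hJ (hcomp o j) (hcomp j o)) (hu' o j o))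
      (heu o)
  obtain ⟨b, hb, hbJ, hbx⟩ := h.exists_left_inverse he J hJ hJnil (haP.mul h hpP) hap
  have hqP : Peirce e o j (b * a) := hb.mul h haP
  have hqp : (b * a) * p = e o := by rw [hb.assoc_cyclic' h haP hpP hoj, hbx]
  have hqu : b * a - u o j ∈ J := by
    have h3 : b - u o o ∈ J := by simpa using J.add_mem hbJ (heu o)
    simpa using J.add_mem (mul_sub_mul_mem hJ h3 (hcomp o j)) (hu' o o j)
  refine ⟨p, b * a, hpP, hqP, hqp, ?_, hcomp j o, hqu⟩
  set q := b * a
  have hz : Peirce e j j (p * q) := hpP.mul h hqP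
  have hzz : (p * q) * (p * q) = p * q := by
    rw [hpP.assoc_cyclic h hqP hz hoj.symm, ← h.flexible, hqp, hqP.left_mul]
  have hzJ : e j - p * q ∈ J := by
    have h3 := J.sub_mem (heu j)
      (J.add_mem (mul_sub_mul_mem hJ (hcomp j o) hqu) (hu' j o j))
    simpa using h3
  have hej := peirce_self he j
  refine (sub_eq_zero.1 (eq_zero_of_isNilElem ?_ (hJnil _ hzJ))).symm
  rw [mul_sub, sub_mul, sub_mul, hzz, hz.left_mul, hz.right_mul, hej.left_mul]
  abel

/-- Links to a common idempotent assemble to matrix units. -/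
theorem matrix_units_of_links {ι : Type*} [DecidableEq ι] (h : IsAlternative U)
    (h2 : ∀ x : U, x + x = 0 → x = 0) {e : ι → U}
    (he : ∀ m n, e m * e n = if m = n then e m else 0) (o : ι) {p q : ι → U}
    (hp : ∀ j, Peirce e j o (p j)) (hq : ∀ j, Peirce e o j (q j))
    (hqp : ∀ j, q j * p j = e o) (hpo : p o = e o) (hqo : q o = e o) (i j k l : ι) :
    (p i * q j) * (p k * q l) = if j = k then p i * q l else 0 := by
  have hid : ∀ m, e m * e m = e m := fun m => by simpa using he m m
  have hP : ∀ i j, Peirce e i j (p i * q j) := fun i j => (hp i).mul h (hq j)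
  split_ifs with hjk
  · subst hjk
    have hql : q j * (p j * q l) = q l := by
      by_cases hjl : j = l
      · rw [← hjl, ← h.flexible, hqp, (hq j).left_mul]
      · have h3 : (q j * p j) * q l = q j * (p j * q l) := by
          by_cases hlo : l = o
          · rw [hlo, hqo, hqp, (hp j).right_mul, hqp, hid]
          · have hoj : ¬ (j = o ∧ l = j) := fun h' => hjl h'.2.symm
            rw [← sub_eq_zero, h.associator_cyclic,
              (hP j l).mul_eq_zero h h2 hid (hq j) hlo hoj,
              (hq l).mul_eq_zero h h2 hid (hq j) hlo fun h' => hjl h'.2.symm, mul_zero, sub_self]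
        rw [← h3, hqp, (hq l).left_mul]
    have hpj : (p i * q j) * p j = p i := by
      by_cases hij : i = j
      · rw [hij, h.flexible, hqp, (hp j).right_mul]
      · have h3 : (p i * q j) * p j = p i * (q j * p j) := by
          by_cases hio : i = o
          · rw [hio, hpo, (hq j).left_mul, hqp, hid]
          · rw [← sub_eq_zero, ← h.associator_cyclic (p j),
              (hp j).mul_eq_zero h h2 hid (hp i) (Ne.symm hio) fun h' => hij h'.1.symm,
              (hp j).mul_eq_zero h h2 hid (hP i j) (Ne.symm hio) fun h' => hij h'.1.symm,
              zero_mul, sub_self]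
        rw [h3, hqp, (hp i).right_mul]
    have h3 : (p i * q j) * (p j * q l) = p i * (q j * (p j * q l)) := by
      by_cases hjo : j = o
      · rw [hjo, hqo, (hp i).right_mul, (hP o l).left_mul]
      by_cases hlo : l = o
      · rw [hlo, hqo, (hp j).right_mul, hpj, hqp, (hp i).right_mul]
      by_cases hio : i = o
      · rw [hio, hpo, (hq j).left_mul, hql, (hq l).left_mul]
      by_cases hli : l = i
      · subst hli
        exact (hp l).assoc_cyclic h (hq j) (hP j l) hio
      · rw [← sub_eq_zero, ← h.associator_cyclic (p j * q l),
          (hP j l).mul_eq_zero h h2 hid (hp i) hli fun h' => hlo h'.2,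
          (hP j l).mul_eq_zero h h2 hid (hP i j) hli fun h' => hli (h'.2.trans h'.1),
          zero_mul, sub_self]
    rw [h3, hql]
  · by_cases hne : i = k ∧ j = l
    · obtain ⟨rfl, rfl⟩ := hne
      exact (hP i j).mul_self h (Ne.symm hjk)
    · exact (hP i j).mul_eq_zero h h2 hid (hP k l) hjk hne

variable [SMulCommClass F U U]

theorem mulLeft_pow_one (h : IsAlternative U) (x : U) (n : ℕ) :
    LinearMap.mulLeft F (((LinearMap.mulLeft F x) ^ n) 1) = (LinearMap.mulLeft F x) ^ n := by
  have hcomm : ∀ m,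
      ((LinearMap.mulLeft F x) ^ m) 1 * x = ((LinearMap.mulLeft F x) ^ (m + 1)) 1 := by
    intro m
    induction m with
    | zero => simp
    | succ m ih =>
      rw [pow_succ', Module.End.mul_apply, LinearMap.mulLeft_apply, h.flexible, ih,
        pow_succ' _ (m + 1), Module.End.mul_apply, LinearMap.mulLeft_apply]
  induction n using Nat.twoStepInduction with
  | zero => ext; simp
  | one => ext; simp
  | more n ih _ =>
    ext y
    have h1 := LinearMap.congr_fun ih (x * y)
    rw [LinearMap.mulLeft_apply] at h1
    rw [pow_succ', Module.End.mul_apply, ← hcomm, LinearMap.mulLeft_apply, LinearMap.mulLeft_apply,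
      h.left_moufang, h1]
    simp only [pow_succ', Module.End.mul_apply, LinearMap.mulLeft_apply]
    rw [← LinearMap.mulLeft_apply (R := F) x y, ← Module.End.mul_apply, ← pow_succ, pow_succ',
      Module.End.mul_apply, LinearMap.mulLeft_apply]

variable [IsScalarTower F U U]

/-- Evaluation of a polynomial at `x`. -/
noncomputable def evalAt (F : Type*) {U : Type*} [Field F] [NonAssocRing U] [Module F U]
    [SMulCommClass F U U] [IsScalarTower F U U] (x : U) (p : Polynomial F) : U :=
  Polynomial.aeval (LinearMap.mulLeft F x) p 1

theorem evalAt_mul (h : IsAlternative U) (x : U) (p q : Polynomial F) :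
    evalAt F x (p * q) = evalAt F x p * evalAt F x q := by
  have key : LinearMap.mulLeft F (evalAt F x p) = Polynomial.aeval (LinearMap.mulLeft F x) p := by
    induction p using Polynomial.induction_on' with
    | add p q hp hq =>
      rw [map_add, ← hp, ← hq]
      ext y
      simp [evalAt, add_mul]
    | monomial n a =>
      rw [Polynomial.aeval_monomial, ← Algebra.smul_def, ← h.mulLeft_pow_one]
      ext y
      simp [evalAt, Polynomial.aeval_monomial, ← Algebra.smul_def, smul_mul_assoc]
  rw [← LinearMap.mulLeft_apply (R := F) (evalAt F x p), key, evalAt, map_mul,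
    Module.End.mul_apply, evalAt]

theorem evalAt_sub (x : U) (p q : Polynomial F) :
    evalAt F x (p - q) = evalAt F x p - evalAt F x q := by
  simp [evalAt]

theorem evalAt_X (x : U) : evalAt F x Polynomial.X = x := by
  simp [evalAt]

theorem evalAt_X_mul_mem {x : U} (S : Submodule F U) (hx : x ∈ S)
    (hS : ∀ y ∈ S, x * y ∈ S) (p : Polynomial F) : evalAt F x (Polynomial.X * p) ∈ S := by
  rw [mul_comm, evalAt, map_mul, Module.End.mul_apply, Polynomial.aeval_X,
    LinearMap.mulLeft_apply, mul_one]
  induction p using Polynomial.induction_on' with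
  | add p q hp hq => rw [map_add]; exact S.add_mem hp hq
  | monomial n a =>
    rw [Polynomial.aeval_monomial, ← Algebra.smul_def]
    refine S.smul_mem _ ?_
    induction n with
    | zero => simpa
    | succ n ih => rw [pow_succ']; exact hS _ ih

theorem evalAt_pow_succ (h : IsAlternative U) (x : U) (p : Polynomial F) (n : ℕ) :
    evalAt F x (p ^ (n + 1)) = lpow (evalAt F x p) n := by
  induction n with
  | zero => rw [zero_add, pow_one, lpow]
  | succ n ih => rw [pow_succ', h.evalAt_mul, ih, lpow]

open Polynomial in
theorem exists_idempotent_polynomial (F : Type*) [Field F] (n : ℕ) :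
    ∃ s r v : F[X], (X * s) * (X * s) - X * s = (X * X - X) ^ (n + 1) * v ∧
      X * s - X = r * (X * X - X) := by
  have hco : IsCoprime (X : F[X]) (1 - X) := ⟨1, 1, by ring⟩
  obtain ⟨a, b, hab⟩ := hco.pow (m := n + 1) (n := n + 1)
  have h1 : (X : F[X]) ∣ a * X ^ (n + 1) - X :=
    dvd_sub (Dvd.intro_left (a * X ^ n) (by ring)) dvd_rfl
  have h2 : (1 - X : F[X]) ∣ a * X ^ (n + 1) - X := by
    rw [eq_sub_of_add_eq hab]
    exact ⟨1 - b * (1 - X) ^ n, by ring⟩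
  obtain ⟨r, hr⟩ := hco.mul_dvd h1 h2
  refine ⟨a * X ^ n, -r, (-1) ^ n * (a * b), ?_, ?_⟩
  · have h3 : (X * X - X : F[X]) ^ (n + 1) =
        (-1) ^ (n + 1) * (X ^ (n + 1) * (1 - X) ^ (n + 1)) := by
      rw [← mul_pow, ← mul_pow]
      ring
    have h4 : ((-1 : F[X]) ^ n) * (-1) ^ n = 1 := by rw [← mul_pow]; simp
    rw [h3]
    linear_combination (a * X ^ (n + 1)) * hab +
      (a * b * X ^ (n + 1) * (1 - X) ^ (n + 1)) * h4
  · linear_combination hr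

/-- Idempotents of a corner lift modulo a nil ideal. -/
theorem exists_idempotent_lift (h : IsAlternative U) (J : Submodule F U)
    (hJ : ∀ x ∈ J, ∀ y : U, y * x ∈ J ∧ x * y ∈ J) (hJnil : ∀ x ∈ J, IsNilElem x)
    {e x : U} (hex : e * x = x) (hxe : x * e = x) (hxx : x * x - x ∈ J) :
    ∃ c : U, c * c = c ∧ e * c = c ∧ c * e = c ∧ c - x ∈ J := by
  obtain ⟨n, hn⟩ := hJnil _ hxx
  obtain ⟨s, r, v, h1, h2⟩ := exists_idempotent_polynomial F n
  have hd : evalAt F x (Polynomial.X * Polynomial.X - Polynomial.X) = x * x - x := by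
    rw [evalAt_sub, h.evalAt_mul, evalAt_X]
  have hcorner : evalAt F x (Polynomial.X * s) ∈
      LinearMap.eqLocus (LinearMap.mulLeft F e) LinearMap.id ⊓
        LinearMap.eqLocus (LinearMap.mulRight F e) LinearMap.id := by
    refine evalAt_X_mul_mem _ (Submodule.mem_inf.2 ⟨hex, hxe⟩) (fun y hy => ?_) s
    have hey : e * y = y := hy.1
    have hye : y * e = y := hy.2
    refine Submodule.mem_inf.2 ⟨?_, ?_⟩
    · change e * (x * y) = x * y
      rw [h.mul_mul_eq, hex, hxe, hey, add_sub_cancel_right]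
    · change (x * y) * e = x * y
      rw [h.mul_mul_eq', hxe, hey, hye, add_sub_cancel_right]
  refine ⟨evalAt F x (Polynomial.X * s), ?_, hcorner.1, hcorner.2, ?_⟩
  · rw [← h.evalAt_mul, ← sub_eq_zero, ← evalAt_sub, h1, h.evalAt_mul, h.evalAt_pow_succ, hd, hn,
      zero_mul]
  · have h3 := congrArg (evalAt F x) h2
    rw [evalAt_sub, h.evalAt_mul (p := r), hd, evalAt_X] at h3
    rw [h3]
    exact (hJ _ hxx _).1

/-- Families of orthogonal idempotents with given sum lift modulo a nil ideal. -/
theorem exists_orthogonal_lift {ι : Type*} [DecidableEq ι] (h : IsAlternative U)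
    (h2 : ∀ x : U, x + x = 0 → x = 0) (J : Submodule F U)
    (hJ : ∀ x ∈ J, ∀ y : U, y * x ∈ J ∧ x * y ∈ J) (hJnil : ∀ x ∈ J, IsNilElem x)
    (u : ι → U) (hu : ∀ i j, u i * u j - (if i = j then u i else 0) ∈ J) (s : Finset ι) :
    ∀ e : U, e * e = e → e - ∑ i ∈ s, u i ∈ J →
      ∃ c : ι → U, (∀ i ∈ s, ∀ j ∈ s, c i * c j = if i = j then c i else 0) ∧
        (∀ i ∈ s, e * c i = c i ∧ c i * e = c i) ∧ (∀ i ∈ s, c i - u i ∈ J) ∧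
        ∑ i ∈ s, c i = e := by
  induction s using Finset.induction_on with
  | empty =>
    intro e he heJ
    rw [Finset.sum_empty, sub_zero] at heJ
    exact ⟨0, by simp, by simp, by simp, by simp [eq_zero_of_isNilElem he (hJnil _ heJ)]⟩
  | insert a s ha ih =>
    intro e he heJ
    have hidem : ∀ y, e * (e * y) = e * y ∧ (y * e) * e = y * e := h.idem_mul he
    have hl : e * u a - u a ∈ J := by
      have h3 := mul_sub_mul_mem hJ heJ (y := u a) (y' := u a) (by simp)
      have h4 := J.sum_mem fun i (_ : i ∈ insert a s) => hu i a
      rw [Finset.sum_sub_distrib, Finset.sum_ite_eq', if_pos (Finset.mem_insert_self a s),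
        ← Finset.sum_mul] at h4
      simpa using J.add_mem h3 h4
    have hr : u a * e - u a ∈ J := by
      have h3 := mul_sub_mul_mem hJ (x := u a) (x' := u a) (by simp) heJ
      have h4 := J.sum_mem fun i (_ : i ∈ insert a s) => hu a i
      rw [Finset.sum_sub_distrib, Finset.sum_ite_eq, if_pos (Finset.mem_insert_self a s),
        ← Finset.mul_sum] at h4
      simpa using J.add_mem h3 h4
    have hx : (e * u a) * e - u a ∈ J := by
      simpa using J.add_mem (mul_sub_mul_mem hJ hl (y := e) (y' := e) (by simp)) hr
    have hxx : ((e * u a) * e) * ((e * u a) * e) - (e * u a) * e ∈ J := by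
      have h3 := J.sub_mem (J.add_mem (mul_sub_mul_mem hJ hx hx) (hu a a)) hx
      simpa using h3
    obtain ⟨c, hcc, hec, hce, hcx⟩ := h.exists_idempotent_lift J hJ hJnil
      (e := e) (by rw [h.flexible, (hidem _).1]) ((hidem _).2) hxx
    have hcu : c - u a ∈ J := by simpa using J.add_mem hcx hx
    have hc' : c * (e - c) = 0 := by rw [mul_sub, hce, hcc, sub_self]
    have hc'' : (e - c) * c = 0 := by rw [sub_mul, hec, hcc, sub_self]
    have he' : (e - c) * (e - c) = e - c := by
      rw [sub_mul e c, hc', mul_sub, he, hec, sub_zero]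
    obtain ⟨d, hd1, hd2, hd3, hd4⟩ := ih (e - c) he' (by
      rw [Finset.sum_insert ha] at heJ
      have := J.sub_mem heJ hcu
      rwa [show e - c - ∑ i ∈ s, u i = e - (u a + ∑ i ∈ s, u i) - (c - u a) by abel])
    have hne : ∀ i ∈ s, i ≠ a := fun i hi hia => ha (hia ▸ hi)
    have hcd : ∀ i ∈ s, c * d i = 0 := fun i hi =>
      h.mul_eq_zero_left h2 he' hc'' hc' (hd2 i hi).1
    have hdc : ∀ i ∈ s, d i * c = 0 := fun i hi =>
      h.mul_eq_zero_right h2 he' (hd2 i hi).2 hc'' hc'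
    refine ⟨fun i => if i = a then c else d i, ?_, ?_, ?_, ?_⟩
    · intro i hi j hj
      rcases Finset.mem_insert.1 hi with hia | his <;>
        rcases Finset.mem_insert.1 hj with hja | hjs
      · simp [hia, hja, hcc]
      · simp [hia, hne j hjs, (hne j hjs).symm, hcd j hjs]
      · simp [hja, hne i his, hdc i his]
      · simp [hne i his, hne j hjs, hd1 i his j hjs]
    · intro i hi
      rcases Finset.mem_insert.1 hi with rfl | hi
      · simp [hec, hce]
      · have h3 := hd2 i hi
        rw [sub_mul, hcd i hi, mul_sub, hdc i hi, sub_zero, sub_zero] at h3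
        simpa [hne i hi] using h3
    · intro i hi
      rcases Finset.mem_insert.1 hi with rfl | hi
      · simpa using hcu
      · simpa [hne i hi] using hd3 i hi
    · rw [Finset.sum_insert ha, if_pos rfl,
        Finset.sum_congr rfl fun i hi => if_neg (hne i hi), hd4, add_sub_cancel]

end Lifting

end IsAlternative

/-- Let `(U, ω)` be a finite-dimensional b-alternative algebra over `F` with
unity element `1` and `J` a nil b-ideal of `U`.  If the classes of the
`u_{ij} ∈ bar(U)` are matrix units of degree `t` in `bar(U)/J` and `f` is an
idempotent of `bar(U)` with `f ≡ u_{11} + ⋯ + u_{tt} (mod J)`, then `bar(U)`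
contains matrix units `f_{ij}` of degree `t` with `f_{ij} ≡ u_{ij} (mod J)` and
`f_{11} + ⋯ + f_{tt} = f`. -/
theorem matrix_algebra_lifting
    (F : Type*) [Field F]
    (hchar : ringChar F ≠ 2 ∧ ringChar F ≠ 3 ∧ ringChar F ≠ 5)
    (U : Type*) [NonAssocRing U] [Module F U]
    [SMulCommClass F U U] [IsScalarTower F U U] [FiniteDimensional F U]
    (halt : ∀ x y : U, (x * x) * y = x * (x * y) ∧ (y * x) * x = y * (x * x))
    (ω : U →ₗ[F] F) (hωmul : ∀ x y : U, ω (x * y) = ω x * ω y) (hω0 : ω ≠ 0)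
    (J : Submodule F U)
    (hJbar : ∀ x ∈ J, ω x = 0)
    (hJideal : ∀ x ∈ J, ∀ y : U, y * x ∈ J ∧ x * y ∈ J)
    (hJnil : ∀ x ∈ J, IsNilElem x)
    (t : ℕ) (u : Fin t → Fin t → U)
    (hubar : ∀ i j, ω (u i j) = 0)
    (humul : ∀ i j k l, u i j * u k l - (if j = k then u i l else 0) ∈ J)
    (hunz : ∀ i, u i i ∉ J)
    (f : U) (hfbar : ω f = 0) (hfidem : f * f = f)
    (hfu : f - ∑ i, u i i ∈ J) :
    ∃ g : Fin t → Fin t → U,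
      (∀ i j, ω (g i j) = 0) ∧
      (∀ i j k l, g i j * g k l = if j = k then g i l else 0) ∧
      (∀ i j, g i j - u i j ∈ J) ∧
      ∑ i, g i i = f := by
  have h : IsAlternative U := halt
  have h2 : ∀ x : U, x + x = 0 → x = 0 := fun x hx => by
    rw [← two_smul F, smul_eq_zero] at hx
    exact hx.resolve_left (Ring.two_ne_zero hchar.1)
  rcases isEmpty_or_nonempty (Fin t) with _ | ⟨⟨o⟩⟩
  · rw [Finset.univ_eq_empty, Finset.sum_empty, sub_zero] at hfu
    refine ⟨u, fun i => isEmptyElim i, fun i => isEmptyElim i, fun i => isEmptyElim i, ?_⟩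
    rw [Finset.univ_eq_empty, Finset.sum_empty,
      IsAlternative.eq_zero_of_isNilElem hfidem (hJnil _ hfu)]
  have hdiag : ∀ i j, u i i * u j j - (if i = j then u i i else 0) ∈ J := fun i j => by
    have := humul i i j j
    split_ifs at this ⊢ with hij
    · rwa [← hij] at this ⊢
    · exact this
  obtain ⟨e, he, -, heu, hsum⟩ := h.exists_orthogonal_lift h2 J hJideal hJnil
    (fun i => u i i) hdiag Finset.univ f hfidem hfu
  replace he : ∀ m n, e m * e n = if m = n then e m else 0 := fun m n => he m (by simp) n (by simp)
  replace heu : ∀ i, e i - u i i ∈ J := fun i => heu i (by simp)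
  have hlink : ∀ j, ∃ p q, IsAlternative.Peirce e j o p ∧ IsAlternative.Peirce e o j q ∧
      q * p = e o ∧ p * q = e j ∧ p - u j o ∈ J ∧ q - u o j ∈ J ∧
      (j = o → p = e o ∧ q = e o) := fun j => by
    by_cases hj : o = j
    · subst hj
      have hP := IsAlternative.peirce_self he o
      exact ⟨e o, e o, hP, hP, hP.left_mul, hP.left_mul, heu o, heu o, fun _ => ⟨rfl, rfl⟩⟩
    · obtain ⟨p, q, h3, h4, h5, h6, h7, h8⟩ :=
        h.exists_link_lift h2 he J hJideal hJnil u humul heu hj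
      exact ⟨p, q, h3, h4, h5, h6, h7, h8, fun h' => absurd h'.symm hj⟩
  choose p q hp hq hqp hpq hpu hqu ho using hlink
  have hgu : ∀ i j, p i * q j - u i j ∈ J := fun i j => by
    have h3 : u i o * u o j - u i j ∈ J := by simpa using humul i o o j
    simpa using J.add_mem (IsAlternative.mul_sub_mul_mem hJideal (hpu i) (hqu j)) h3
  refine ⟨fun i j => p i * q j, fun i j => ?_,
    h.matrix_units_of_links h2 he o hp hq hqp (ho o rfl).1 (ho o rfl).2, hgu, ?_⟩
  · have h3 := hJbar _ (hgu i j)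
    rwa [map_sub, hubar, sub_zero] at h3
  · rw [← hsum]
    exact Finset.sum_congr rfl fun i _ => hpq i
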